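/- There exists a universal constant A > 0 (one may take A = 2e² Σ_{m=0}^∞ (e/3)^m (m+2)^{3/2}) such that for every probability measure μ on ℝ with infinite support and all moments finite, every bounded measurable f : ℝ → ℝ, every n ∈ ℕ, and every real t with |t| ≤ 1/(3‖f‖_∞), the moment generating function of the linear statistic of the OPE of size n satisfies | log E[exp(t X_f^{(n)})] − t·E[X_f^{(n)}] | ≤ A t² Var X_f^{(n)}. -/

import Mathlib

open MeasureTheory ProbabilityTheory Filter Topology

noncomputable section

/-- The squared Vandermonde determinant `∏_{i>j} (λ_i - λ_j)^2`. -/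
def vandSq {n : ℕ} (l : Fin n → ℝ) : ℝ :=
  ∏ q ∈ Finset.univ.filter (fun q : Fin n × Fin n => q.2 < q.1), (l q.1 - l q.2) ^ 2

/-- The orthogonal polynomial ensemble of size `n` associated with `μ`: the probability
measure on `ℝ^n` proportional to `∏_{i>j}(λ_i-λ_j)^2 dμ(λ_1)⋯dμ(λ_n)`. -/
def OPE (μ : Measure ℝ) (n : ℕ) : Measure (Fin n → ℝ) :=
  ((((Measure.pi fun _ : Fin n => μ).withDensity fun l => ENNReal.ofReal (vandSq l))
    Set.univ)⁻¹) •
    ((Measure.pi fun _ : Fin n => μ).withDensity fun l => ENNReal.ofReal (vandSq l))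

/-- The linear statistic `X_f = ∑ f(λ_j)`. -/
def linStat {n : ℕ} (f : ℝ → ℝ) (l : Fin n → ℝ) : ℝ := ∑ j, f (l j)

/-- The scaled linear statistic `X_{f,α,x*} = ∑ f(n^α (λ_j - x*))`. -/
def scaledLinStat {n : ℕ} (f : ℝ → ℝ) (α xs : ℝ) (l : Fin n → ℝ) : ℝ :=
  ∑ j, f ((n : ℝ) ^ α * (l j - xs))

/-- `p` is the family of orthonormal polynomials of `μ`: `p j` has degree `j`, positive
leading coefficient, and `∫ p_i p_j dμ = δ_{ij}`. -/
def IsOrthonormalPolys (μ : Measure ℝ) (p : ℕ → Polynomial ℝ) : Prop :=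
  (∀ j, (p j).degree = (j : WithBot ℕ)) ∧ (∀ j, 0 < (p j).leadingCoeff) ∧
    ∀ i j, ∫ x, (p i).eval x * (p j).eval x ∂μ = if i = j then 1 else 0

/-- All moments of `μ` are finite. -/
def HasAllMoments (μ : Measure ℝ) : Prop := ∀ k : ℕ, Integrable (fun x : ℝ => x ^ k) μ

/-- `μ` has infinite support: no finite set carries full `μ`-measure. -/
def InfiniteSupport (μ : Measure ℝ) : Prop := ∀ s : Finset ℝ, μ ((↑s : Set ℝ)ᶜ) ≠ 0

/-- The Christoffel–Darboux kernel `K_n(x,y) = ∑_{j<n} p_j(x) p_j(y)`. -/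
def CDKernel (p : ℕ → Polynomial ℝ) (n : ℕ) (x y : ℝ) : ℝ :=
  ∑ j ∈ Finset.range n, (p j).eval x * (p j).eval y

/-- The sup norm `‖f‖_∞` of a (bounded) function. -/
def supNorm (f : ℝ → ℝ) : ℝ := ⨆ x, |f x|

/-- The (topological) support of a measure on `ℝ`. -/
def measSupport (μ : Measure ℝ) : Set ℝ := {x | ∀ U ∈ 𝓝 x, μ U ≠ 0}

/-- The sine kernel `sin(πt)/(πt)` (equal to `1` at `t = 0`). -/
def sineKernel (t : ℝ) : ℝ := if t = 0 then 1 else Real.sin (Real.pi * t) / (Real.pi * t)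

/-- `K̃_n(x,y) = w(x)^{1/2} w(y)^{1/2} K_n(x,y)`, where `w` is the Radon–Nikodym
derivative of `μ` with respect to Lebesgue measure. -/
def tildeK (μ : Measure ℝ) (Kf : ℝ → ℝ → ℝ) (x y : ℝ) : ℝ :=
  Real.sqrt ((μ.rnDeriv volume x).toReal) * Real.sqrt ((μ.rnDeriv volume y).toReal) * Kf x y

/-- The Nevai condition at `x*` for a sequence of measures with kernels `Kf n`. -/
def NevaiCond (μ : ℕ → Measure ℝ) (Kf : ℕ → ℝ → ℝ → ℝ) (xs : ℝ) : Prop :=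
  ∀ f : ℝ → ℝ, Continuous f → HasCompactSupport f →
    Tendsto (fun n => ∫ y, (f y - f xs) * Kf n xs y ^ 2 / Kf n xs xs ∂(μ n)) atTop (𝓝 0)

/-- The `α`-Nevai condition at `x*` for a sequence of measures with kernels `Kf n`. -/
def AlphaNevaiCond (μ : ℕ → Measure ℝ) (Kf : ℕ → ℝ → ℝ → ℝ) (α xs : ℝ) : Prop :=
  ∀ f : ℝ → ℝ, Continuous f → HasCompactSupport f →
    ∀ S : Set ℝ, IsCompact S →
      TendstoUniformlyOn
        (fun n s => ∫ y, (f s - f ((n : ℝ) ^ α * (y - xs))) *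
            Kf n (xs + s / (n : ℝ) ^ α) y ^ 2 /
            Kf n (xs + s / (n : ℝ) ^ α) (xs + s / (n : ℝ) ^ α) ∂(μ n))
        (fun _ => 0) atTop S

open Matrix

section MatrixIdentities

variable {ι R : Type*} [Fintype ι] [DecidableEq ι] [CommRing R]

/-- The first variation of the determinant along `W`, as a trace against the adjugate. -/
lemma sum_det_updateRow (M W : Matrix ι ι R) :
    ∑ i, (M.updateRow i (W i)).det = (W * M.adjugate).trace := by
  refine Finset.sum_congr rfl fun i _ => ?_
  rw [← Matrix.cramer_transpose_apply, Matrix.cramer_eq_adjugate_mulVec,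
    ← Matrix.adjugate_transpose, Matrix.diag_apply, Matrix.mul_apply]
  exact Finset.sum_congr rfl fun j _ => mul_comm _ _

lemma sum_sub_trace_mul_det (M N : Matrix ι ι R) (v : ι → R) :
    (∑ j, v j - N.trace) * M.det =
      ∑ i, (M.updateRow i ((M * diagonal v - N * M) i)).det := by
  rw [sum_det_updateRow, sub_mul, sub_mul, trace_sub, Matrix.mul_assoc N, Matrix.mul_adjugate,
    Matrix.trace_mul_comm, ← Matrix.mul_assoc, Matrix.adjugate_mul]
  simp [Matrix.trace, Finset.sum_mul, mul_comm, Finset.mul_sum, smul_eq_mul]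

end MatrixIdentities

section Andreief

variable {n : ℕ} {μ : Measure ℝ} [SigmaFinite μ]

/-- The Slater determinant `det (φ_i(l_j))`. -/
def slater (φ : Fin n → ℝ → ℝ) (l : Fin n → ℝ) : ℝ :=
  (Matrix.of fun i j => φ i (l j)).det

lemma slater_mul_slater (φ ψ : Fin n → ℝ → ℝ) (l : Fin n → ℝ) :
    slater φ l * slater ψ l = ∑ τ : Equiv.Perm (Fin n), ∑ σ : Equiv.Perm (Fin n),
      ((σ.sign : ℤ) : ℝ) * ((τ.sign : ℤ) : ℝ) * ∏ j, (φ (σ j) (l j) * ψ (τ j) (l j)) := by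
  simp only [slater, Matrix.det_apply', Matrix.of_apply, Finset.sum_mul_sum]
  rw [Finset.sum_comm]
  refine Finset.sum_congr rfl fun τ _ => Finset.sum_congr rfl fun σ _ => ?_
  rw [Finset.prod_mul_distrib]
  ring

lemma integrable_slater_mul_slater {φ ψ : Fin n → ℝ → ℝ} (hφ : ∀ i, MemLp (φ i) 2 μ)
    (hψ : ∀ i, MemLp (ψ i) 2 μ) :
    Integrable (fun l => slater φ l * slater ψ l) (Measure.pi fun _ : Fin n => μ) := by
  simp only [slater_mul_slater]
  refine integrable_finsetSum _ fun τ _ => integrable_finsetSum _ fun σ _ => ?_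
  refine Integrable.const_mul ?_ _
  exact Integrable.fintype_prod (f := fun j x => φ (σ j) x * ψ (τ j) x)
    fun j => (hφ _).integrable_mul (hψ _)

/-- The Andréief identity. -/
lemma integral_slater_mul_slater {φ ψ : Fin n → ℝ → ℝ} (hφ : ∀ i, MemLp (φ i) 2 μ)
    (hψ : ∀ i, MemLp (ψ i) 2 μ) :
    ∫ l, slater φ l * slater ψ l ∂(Measure.pi fun _ : Fin n => μ) =
      n.factorial * (Matrix.of fun i j => ∫ x, φ i x * ψ j x ∂μ).det := by
  have hint : ∀ σ τ : Equiv.Perm (Fin n), Integrable (fun l : Fin n → ℝ =>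
      ((σ.sign : ℤ) : ℝ) * ((τ.sign : ℤ) : ℝ) * ∏ j, (φ (σ j) (l j) * ψ (τ j) (l j)))
      (Measure.pi fun _ : Fin n => μ) := fun σ τ =>
    (Integrable.fintype_prod (f := fun j x => φ (σ j) x * ψ (τ j) x)
      fun j => (hφ _).integrable_mul (hψ _)).const_mul _
  set G : Matrix (Fin n) (Fin n) ℝ := Matrix.of fun i j => ∫ x, φ i x * ψ j x ∂μ with hG
  simp only [slater_mul_slater]
  rw [integral_finsetSum _ fun τ _ => integrable_finsetSum _ fun σ _ => hint σ τ]
  have hτ : ∀ τ : Equiv.Perm (Fin n), ∫ l : Fin n → ℝ, ∑ σ : Equiv.Perm (Fin n),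
      ((σ.sign : ℤ) : ℝ) * ((τ.sign : ℤ) : ℝ) * ∏ j, (φ (σ j) (l j) * ψ (τ j) (l j))
        ∂(Measure.pi fun _ : Fin n => μ) = G.det := by
    intro τ
    rw [integral_finsetSum _ fun σ _ => hint σ τ]
    have h := Matrix.det_permute' τ G
    have hs : ((τ.sign : ℤ) : ℝ) * ((τ.sign : ℤ) : ℝ) = 1 := by
      rw [← Int.cast_mul, Int.units_coe_mul_self, Int.cast_one]
    calc _ = ((τ.sign : ℤ) : ℝ) * (G.submatrix id τ).det := by
          rw [Matrix.det_apply', Finset.mul_sum]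
          refine Finset.sum_congr rfl fun σ _ => ?_
          rw [integral_const_mul,
            integral_fintype_prod_eq_prod (f := fun j x => φ (σ j) x * ψ (τ j) x)]
          simp only [hG, Matrix.submatrix_apply, Matrix.of_apply, id]
          ring
      _ = G.det := by rw [h, ← mul_assoc, hs, one_mul]
  rw [Finset.sum_congr rfl fun τ _ => hτ τ]
  simp [Fintype.card_perm]

end Andreief

section SimultaneousDiagonalization

lemma Matrix.PosDef.exists_simultaneous_diagonalization {ι : Type*} [Fintype ι] [DecidableEq ι]
    {A S : Matrix ι ι ℝ} (hA : A.PosDef) (hS : S.IsHermitian) :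
    ∃ (B : Matrix ι ι ℝ) (d : ι → ℝ), B * A * Bᵀ = 1 ∧ B * S * Bᵀ = diagonal d := by
  obtain ⟨y, hy⟩ : ∃ y : Matrix ι ι ℝ, A = yᵀ * y := by
    open scoped MatrixOrder ComplexOrder in
    obtain ⟨y, hy⟩ := CStarAlgebra.nonneg_iff_eq_star_mul_self.mp hA.posSemidef.nonneg
    exact ⟨y, by simpa [star_eq_conjTranspose] using hy⟩
  have hdet : IsUnit y.det := by
    have h := hA.det_pos
    rw [hy, det_mul, det_transpose] at h
    exact isUnit_iff_ne_zero.mpr fun h0 => by simp [h0] at h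
  have hC : (y⁻¹)ᵀ * A * y⁻¹ = 1 := by
    rw [hy, ← Matrix.mul_assoc, ← transpose_mul, mul_nonsing_inv _ hdet, transpose_one,
      Matrix.one_mul, mul_nonsing_inv _ hdet]
  have hT : ((y⁻¹)ᵀ * S * y⁻¹).IsHermitian := by
    simpa using Matrix.isHermitian_conjTranspose_mul_mul y⁻¹ hS
  obtain ⟨U, d, hUU, hspec⟩ : ∃ (U : Matrix ι ι ℝ) (d : ι → ℝ), Uᵀ * U = 1 ∧
      (y⁻¹)ᵀ * S * y⁻¹ = U * diagonal d * Uᵀ := by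
    refine ⟨hT.eigenvectorUnitary, hT.eigenvalues, ?_, ?_⟩
    · simpa [star_eq_conjTranspose] using Unitary.coe_star_mul_self hT.eigenvectorUnitary
    · simpa [Unitary.conjStarAlgAut_apply, star_eq_conjTranspose, Function.comp_def] using
        hT.spectral_theorem
  refine ⟨Uᵀ * (y⁻¹)ᵀ, d, ?_, ?_⟩
  · calc _ = Uᵀ * ((y⁻¹)ᵀ * A * y⁻¹) * U := by
          simp only [transpose_mul, transpose_transpose, Matrix.mul_assoc]
      _ = 1 := by rw [hC, Matrix.mul_one, hUU]
  · calc _ = Uᵀ * ((y⁻¹)ᵀ * S * y⁻¹) * U := by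
          simp only [transpose_mul, transpose_transpose, Matrix.mul_assoc]
      _ = (Uᵀ * U) * diagonal d * (Uᵀ * U) := by
          rw [hspec]
          simp only [Matrix.mul_assoc]
      _ = _ := by rw [hUU, Matrix.mul_one, Matrix.one_mul]

end SimultaneousDiagonalization

section SlaterVariance

variable {n : ℕ} {μ : Measure ℝ} [SigmaFinite μ]

lemma linStat_sub_trace_mul_slater (f : ℝ → ℝ) (φ : Fin n → ℝ → ℝ) (N : Matrix (Fin n) (Fin n) ℝ)
    (l : Fin n → ℝ) :
    (linStat f l - N.trace) * slater φ l =
      ∑ i, slater (Function.update φ i fun x => f x * φ i x - ∑ k, N i k * φ k x) l := by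
  rw [linStat, slater, sum_sub_trace_mul_det _ N fun j => f (l j)]
  refine Finset.sum_congr rfl fun i _ => ?_
  rw [slater]
  congr 1
  ext a b
  by_cases h : a = i
  · subst h
    simp [Matrix.mul_apply, Matrix.diagonal, mul_comm]
  · simp [h]

/-- The functions `φ` are orthonormal in `L²(μ)`. -/
structure IsOrthonormalFamily (μ : Measure ℝ) (φ : Fin n → ℝ → ℝ) : Prop where
  memLp : ∀ i, MemLp (φ i) 2 μ
  integral_mul : ∀ i j, ∫ x, φ i x * φ j x ∂μ = if i = j then 1 else 0

omit [SigmaFinite μ] in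
lemma memLp_update {φ : Fin n → ℝ → ℝ} {g : ℝ → ℝ} (hφ : ∀ i, MemLp (φ i) 2 μ)
    (hg : MemLp g 2 μ) (i j : Fin n) : MemLp (Function.update φ i g j) 2 μ := by
  by_cases h : j = i
  · subst h; simpa using hg
  · simpa [h] using hφ j

lemma integral_slater_sq {φ : Fin n → ℝ → ℝ} (hφ : IsOrthonormalFamily μ φ) :
    ∫ l, slater φ l ^ 2 ∂(Measure.pi fun _ : Fin n => μ) = n.factorial := by
  simp only [sq]
  rw [integral_slater_mul_slater hφ.memLp hφ.memLp]
  have : (Matrix.of fun i j => ∫ x, φ i x * φ j x ∂μ) = 1 := by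
    ext i j
    simp [hφ.integral_mul, Matrix.one_apply]
  simp [this]

lemma integral_slater_update_mul_slater {φ : Fin n → ℝ → ℝ} (hφ : IsOrthonormalFamily μ φ)
    {g : ℝ → ℝ} (hg : MemLp g 2 μ) (h : ∀ j, ∫ x, g x * φ j x ∂μ = 0) (i : Fin n) :
    ∫ l, slater (Function.update φ i g) l * slater φ l ∂(Measure.pi fun _ : Fin n => μ) = 0 := by
  rw [integral_slater_mul_slater (memLp_update hφ.memLp hg i) hφ.memLp,
    Matrix.det_eq_zero_of_row_eq_zero i, mul_zero]
  intro j
  simp [h]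

lemma integral_slater_update_mul_slater_update {φ g : Fin n → ℝ → ℝ}
    (hφ : IsOrthonormalFamily μ φ) (hg : ∀ i, MemLp (g i) 2 μ)
    (h : ∀ i j, ∫ x, g i x * φ j x ∂μ = 0) (i k : Fin n) :
    ∫ l, slater (Function.update φ i (g i)) l * slater (Function.update φ k (g k)) l
        ∂(Measure.pi fun _ : Fin n => μ) =
      if i = k then n.factorial * ∫ x, g i x ^ 2 ∂μ else 0 := by
  have h' : ∀ i j, ∫ x, φ j x * g i x ∂μ = 0 := fun i j => by
    simpa only [mul_comm] using h i j
  rw [integral_slater_mul_slater (memLp_update hφ.memLp (hg i) i)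
    (memLp_update hφ.memLp (hg k) k)]
  split_ifs with hik
  · subst hik
    have : (Matrix.of fun a b => ∫ x, Function.update φ i (g i) a x *
        Function.update φ i (g i) b x ∂μ) =
        diagonal (Function.update (fun _ => (1 : ℝ)) i (∫ x, g i x ^ 2 ∂μ)) := by
      ext a b
      by_cases ha : a = i <;> by_cases hb : b = i
      · subst ha; subst hb; simp [sq]
      · subst ha; simp [hb, h, Ne.symm hb]
      · subst hb; simp [ha, h']
      · by_cases hab : a = b
        · subst hab; simp [ha, hφ.integral_mul]
        · simp [ha, hb, hφ.integral_mul, hab]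
    rw [this, det_diagonal, Finset.prod_update_of_mem (Finset.mem_univ i)]
    simp
  · rw [Matrix.det_eq_zero_of_row_eq_zero k, mul_zero]
    intro j
    by_cases hj : j = k
    · subst hj; simp [Ne.symm hik, h']
    · simp [Ne.symm hik, hj, hφ.integral_mul, Ne.symm hj]

variable {f : ℝ → ℝ} {φ g : Fin n → ℝ → ℝ} {N : Matrix (Fin n) (Fin n) ℝ}

lemma integral_linStat_sub_trace_mul_slater_sq (hφ : IsOrthonormalFamily μ φ)
    (hg : ∀ i, MemLp (g i) 2 μ) (h : ∀ i j, ∫ x, g i x * φ j x ∂μ = 0)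
    (hgf : ∀ i x, g i x = f x * φ i x - ∑ k, N i k * φ k x) :
    ∫ l, (linStat f l - N.trace) * slater φ l ^ 2 ∂(Measure.pi fun _ : Fin n => μ) = 0 := by
  have hg' : ∀ i, (fun x => f x * φ i x - ∑ k, N i k * φ k x) = g i :=
    fun i => funext fun x => (hgf i x).symm
  simp only [sq, ← mul_assoc, linStat_sub_trace_mul_slater, hg', Finset.sum_mul]
  rw [integral_finsetSum _ fun i _ =>
    integrable_slater_mul_slater (memLp_update hφ.memLp (hg i) i) hφ.memLp]
  exact Finset.sum_eq_zero fun i _ => integral_slater_update_mul_slater hφ (hg i) (h i) i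

lemma integral_linStat_sub_trace_sq_mul_slater_sq (hφ : IsOrthonormalFamily μ φ)
    (hg : ∀ i, MemLp (g i) 2 μ) (h : ∀ i j, ∫ x, g i x * φ j x ∂μ = 0)
    (hgf : ∀ i x, g i x = f x * φ i x - ∑ k, N i k * φ k x) :
    ∫ l, (linStat f l - N.trace) ^ 2 * slater φ l ^ 2 ∂(Measure.pi fun _ : Fin n => μ) =
      n.factorial * ∑ i, ∫ x, g i x ^ 2 ∂μ := by
  have hg' : ∀ i, (fun x => f x * φ i x - ∑ k, N i k * φ k x) = g i :=
    fun i => funext fun x => (hgf i x).symm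
  have hint : ∀ i k, Integrable (fun l => slater (Function.update φ i (g i)) l *
      slater (Function.update φ k (g k)) l) (Measure.pi fun _ : Fin n => μ) := fun i k =>
    integrable_slater_mul_slater (memLp_update hφ.memLp (hg i) i) (memLp_update hφ.memLp (hg k) k)
  simp only [← mul_pow, linStat_sub_trace_mul_slater, hg']
  simp only [sq (Finset.sum _ _), Finset.sum_mul_sum]
  rw [integral_finsetSum _ fun i _ => integrable_finsetSum _ fun k _ => hint i k, Finset.mul_sum]
  refine Finset.sum_congr rfl fun i _ => ?_
  rw [integral_finsetSum _ fun k _ => hint i k]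
  simp [integral_slater_update_mul_slater_update hφ hg h]

end SlaterVariance

section Residual

variable {n : ℕ} {μ : Measure ℝ} {φ : Fin n → ℝ → ℝ} {h : ℝ → ℝ}

/-- The component of `h` orthogonal to the family `φ` in `L²(μ)`. -/
def orthoResidual (μ : Measure ℝ) (φ : Fin n → ℝ → ℝ) (h : ℝ → ℝ) (x : ℝ) : ℝ :=
  h x - ∑ k, (∫ y, h y * φ k y ∂μ) * φ k x

lemma memLp_sum_mul (hφ : ∀ i, MemLp (φ i) 2 μ) (c : Fin n → ℝ) :
    MemLp (fun x => ∑ k, c k * φ k x) 2 μ :=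
  memLp_finsetSum _ fun k _ => (hφ k).const_mul (c k)

lemma memLp_orthoResidual (hφ : ∀ i, MemLp (φ i) 2 μ) (hh : MemLp h 2 μ) :
    MemLp (orthoResidual μ φ h) 2 μ :=
  hh.sub (memLp_sum_mul hφ _)

lemma integral_orthoResidual_mul (hφ : IsOrthonormalFamily μ φ) (hh : MemLp h 2 μ) (j : Fin n) :
    ∫ x, orthoResidual μ φ h x * φ j x ∂μ = 0 := by
  have hint : ∀ k, Integrable (fun x => (∫ y, h y * φ k y ∂μ) * (φ k x * φ j x)) μ := fun k =>
    ((hφ.memLp k).integrable_mul (hφ.memLp j)).const_mul _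
  have hhint : Integrable (fun x => h x * φ j x) μ := hh.integrable_mul (hφ.memLp j)
  simp only [orthoResidual, sub_mul, Finset.sum_mul, mul_assoc]
  rw [integral_sub hhint (integrable_finsetSum _ fun k _ => hint k),
    integral_finsetSum _ fun k _ => hint k]
  simp [integral_const_mul, hφ.integral_mul]

/-- The residual minimizes the `L²` distance to the span of the family. -/
lemma integral_orthoResidual_sq_le (hφ : IsOrthonormalFamily μ φ) (hh : MemLp h 2 μ)
    (b : Fin n → ℝ) :
    ∫ x, orthoResidual μ φ h x ^ 2 ∂μ ≤ ∫ x, (h x - ∑ k, b k * φ k x) ^ 2 ∂μ := by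
  set r := orthoResidual μ φ h with hr
  have hrm : MemLp r 2 μ := memLp_orthoResidual hφ.memLp hh
  set q : ℝ → ℝ := fun x => ∑ k, ((∫ y, h y * φ k y ∂μ) - b k) * φ k x with hq
  have hqm : MemLp q 2 μ := memLp_sum_mul hφ.memLp _
  have hrq : ∫ x, r x * q x ∂μ = 0 := by
    have hint : ∀ k, Integrable
        (fun x => ((∫ y, h y * φ k y ∂μ) - b k) * (r x * φ k x)) μ := fun k =>
      (hrm.integrable_mul (hφ.memLp k)).const_mul _
    simp only [hq, Finset.mul_sum, mul_left_comm (r _)]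
    rw [integral_finsetSum _ fun k _ => hint k]
    exact Finset.sum_eq_zero fun k _ => by
      rw [integral_const_mul, integral_orthoResidual_mul hφ hh, mul_zero]
  have hsplit : ∀ x, (h x - ∑ k, b k * φ k x) ^ 2 = r x ^ 2 + (2 * (r x * q x) + q x ^ 2) := by
    intro x
    simp only [hr, hq, orthoResidual, sub_mul, Finset.sum_sub_distrib]
    ring
  simp only [hsplit]
  have hrqi : Integrable (fun x => 2 * (r x * q x)) μ := (hrm.integrable_mul hqm).const_mul 2
  have hrqi' : Integrable (fun x => 2 * (r x * q x) + q x ^ 2) μ := hrqi.add hqm.integrable_sq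
  rw [integral_add hrm.integrable_sq hrqi',
    integral_add hrqi hqm.integrable_sq, integral_const_mul, hrq]
  have : 0 ≤ ∫ x, q x ^ 2 ∂μ := integral_nonneg fun x => sq_nonneg _
  linarith

lemma MeasureTheory.MemLp.bdd_measurable_mul {f : ℝ → ℝ} (hh : MemLp h 2 μ) (hf : Measurable f) {C : ℝ}
    (hC : ∀ x, |f x| ≤ C) : MemLp (fun x => f x * h x) 2 μ := by
  refine hh.of_le_mul (c := C) (hf.aestronglyMeasurable.mul hh.1) ?_
  filter_upwards with x
  rw [norm_mul]
  exact mul_le_mul_of_nonneg_right (hC x) (norm_nonneg _)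

end Residual

section Ensemble

variable {n : ℕ} {μ : Measure ℝ}

lemma vandSq_eq_det_sq (l : Fin n → ℝ) : vandSq l = (Matrix.vandermonde l).det ^ 2 := by
  rw [vandSq, Matrix.det_vandermonde, Finset.prod_filter, Fintype.prod_prod_type,
    Finset.prod_comm, ← Finset.prod_pow]
  refine Finset.prod_congr rfl fun i _ => ?_
  rw [← Finset.prod_pow, ← Finset.prod_filter]
  congr 1
  ext j
  simp

lemma slater_polynomial (B : Matrix (Fin n) (Fin n) ℝ) (l : Fin n → ℝ) :
    slater (fun i x => ∑ k, B i k * x ^ (k : ℕ)) l = B.det * (Matrix.vandermonde l).det := by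
  rw [slater, ← Matrix.det_transpose (Matrix.vandermonde l), ← Matrix.det_mul]
  rfl

lemma slater_mul_weight (c : Fin n → ℝ) (w : ℝ → ℝ) (φ : Fin n → ℝ → ℝ) (l : Fin n → ℝ) :
    slater (fun i x => c i * (w x * φ i x)) l = (∏ i, c i) * ((∏ j, w (l j)) * slater φ l) := by
  simp only [slater]
  rw [← Matrix.det_mul_row (fun j => w (l j)), ← Matrix.det_mul_column c]
  rfl

lemma measurable_vandSq : Measurable (vandSq : (Fin n → ℝ) → ℝ) := by
  unfold vandSq
  fun_prop

lemma vandSq_nonneg (l : Fin n → ℝ) : 0 ≤ vandSq l := by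
  rw [vandSq_eq_det_sq]; positivity

lemma linStat_mul_exp_slater_sq (f : ℝ → ℝ) (s : ℝ) {φ : Fin n → ℝ → ℝ} {d : Fin n → ℝ}
    (hd : ∀ i, 0 < d i) (l : Fin n → ℝ) :
    Real.exp (s * linStat f l) * slater φ l ^ 2 = (∏ i, d i) *
      slater (fun i x => (√(d i))⁻¹ * (Real.exp (s * f x / 2) * φ i x)) l ^ 2 := by
  rw [slater_mul_weight, mul_pow, mul_pow, ← Finset.prod_pow, ← Finset.prod_pow, ← mul_assoc,
    ← mul_assoc, ← Finset.prod_mul_distrib]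
  congr 1
  rw [Finset.prod_eq_one, one_mul, linStat, Finset.mul_sum, Real.exp_sum]
  · refine Finset.prod_congr rfl fun j _ => ?_
    rw [← Real.exp_nat_mul]
    congr 1
    push_cast
    ring
  · intro i _
    rw [inv_pow, Real.sq_sqrt (hd i).le, mul_inv_cancel₀ (hd i).ne']

variable [SigmaFinite μ] {B : Matrix (Fin n) (Fin n) ℝ}

lemma integral_vandSq_mul_det_sq
    (hB : IsOrthonormalFamily μ fun i x => ∑ k, B i k * x ^ (k : ℕ)) :
    B.det ^ 2 * ∫ l, vandSq l ∂(Measure.pi fun _ : Fin n => μ) = n.factorial := by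
  rw [← integral_slater_sq hB, ← integral_const_mul]
  simp only [slater_polynomial, vandSq_eq_det_sq, mul_pow]

lemma integral_vandSq_pos (hB : IsOrthonormalFamily μ fun i x => ∑ k, B i k * x ^ (k : ℕ)) :
    0 < ∫ l, vandSq l ∂(Measure.pi fun _ : Fin n => μ) := by
  have h := integral_vandSq_mul_det_sq hB
  have hn : (0 : ℝ) < n.factorial := by exact_mod_cast n.factorial_pos
  refine (integral_nonneg fun l => vandSq_nonneg l).lt_of_ne fun h0 => ?_
  rw [← h0, mul_zero] at h
  exact hn.ne h

lemma withDensity_vandSq_univ (hB : IsOrthonormalFamily μ fun i x => ∑ k, B i k * x ^ (k : ℕ)) :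
    ((Measure.pi fun _ : Fin n => μ).withDensity fun l => ENNReal.ofReal (vandSq l)) Set.univ =
      ENNReal.ofReal (∫ l, vandSq l ∂(Measure.pi fun _ : Fin n => μ)) := by
  have hint : Integrable (vandSq : (Fin n → ℝ) → ℝ) (Measure.pi fun _ : Fin n => μ) :=
    Integrable.of_integral_ne_zero (integral_vandSq_pos hB).ne'
  rw [withDensity_apply _ MeasurableSet.univ, Measure.restrict_univ,
    ofReal_integral_eq_lintegral_ofReal hint (ae_of_all _ vandSq_nonneg)]

lemma isProbabilityMeasure_OPE
    (hB : IsOrthonormalFamily μ fun i x => ∑ k, B i k * x ^ (k : ℕ)) :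
    IsProbabilityMeasure (OPE μ n) := by
  constructor
  rw [OPE, Measure.smul_apply, smul_eq_mul, withDensity_vandSq_univ hB]
  refine ENNReal.inv_mul_cancel ?_ ENNReal.ofReal_ne_top
  simpa using integral_vandSq_pos hB

lemma integral_OPE (hB : IsOrthonormalFamily μ fun i x => ∑ k, B i k * x ^ (k : ℕ))
    (F : (Fin n → ℝ) → ℝ) :
    ∫ l, F l ∂(OPE μ n) = (n.factorial : ℝ)⁻¹ *
      ∫ l, F l * slater (fun i x => ∑ k, B i k * x ^ (k : ℕ)) l ^ 2
        ∂(Measure.pi fun _ : Fin n => μ) := by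
  have hpos := integral_vandSq_pos hB
  have hdet := integral_vandSq_mul_det_sq hB
  have hn : (n.factorial : ℝ) ≠ 0 := by exact_mod_cast n.factorial_ne_zero
  have hB0 : B.det ≠ 0 := by
    rintro h0
    rw [h0, sq, zero_mul, zero_mul] at hdet
    exact hn hdet.symm
  rw [OPE, integral_smul_measure, withDensity_vandSq_univ hB, ENNReal.toReal_inv,
    ENNReal.toReal_ofReal hpos.le, integral_withDensity_eq_integral_toReal_smul
      measurable_vandSq.ennreal_ofReal (ae_of_all _ fun _ => ENNReal.ofReal_lt_top)]
  simp only [slater_polynomial, mul_pow, ← vandSq_eq_det_sq, smul_eq_mul,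
    ENNReal.toReal_ofReal (vandSq_nonneg _), mul_left_comm _ (B.det ^ 2)]
  rw [integral_const_mul, ← hdet]
  simp only [mul_comm (vandSq _)]
  field_simp

end Ensemble

section Moments

variable {n : ℕ} {μ : Measure ℝ}

lemma HasAllMoments.memLp_pow (hm : HasAllMoments μ) (k : ℕ) :
    MemLp (fun x : ℝ => x ^ k) 2 μ := by
  rw [memLp_two_iff_integrable_sq (by fun_prop)]
  simpa only [← pow_mul] using hm (k * 2)

/-- The matrix of moments of the signed weight `u` with respect to `μ`. -/
def momentMatrix (μ : Measure ℝ) (n : ℕ) (u : ℝ → ℝ) : Matrix (Fin n) (Fin n) ℝ :=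
  Matrix.of fun i j => ∫ x, u x * x ^ (i : ℕ) * x ^ (j : ℕ) ∂μ

lemma integral_mul_polynomial_mul_polynomial (hm : HasAllMoments μ) {u : ℝ → ℝ}
    (hu : Measurable u) {C : ℝ} (hC : ∀ x, |u x| ≤ C) (a b : Fin n → ℝ) :
    ∫ x, u x * (∑ k, a k * x ^ (k : ℕ)) * (∑ k, b k * x ^ (k : ℕ)) ∂μ =
      a ⬝ᵥ (momentMatrix μ n u *ᵥ b) := by
  have hint : ∀ i j : Fin n, Integrable (fun x => u x * x ^ (i : ℕ) * x ^ (j : ℕ)) μ := fun i j =>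
    ((hm.memLp_pow i).bdd_measurable_mul hu hC).integrable_mul (hm.memLp_pow j)
  have hexp : ∀ x, u x * (∑ k, a k * x ^ (k : ℕ)) * (∑ k, b k * x ^ (k : ℕ)) =
      ∑ i, ∑ j, a i * b j * (u x * x ^ (i : ℕ) * x ^ (j : ℕ)) := by
    intro x
    rw [mul_assoc, Finset.sum_mul_sum, Finset.mul_sum]
    refine Finset.sum_congr rfl fun i _ => ?_
    rw [Finset.mul_sum]
    exact Finset.sum_congr rfl fun j _ => by ring
  simp only [hexp]
  rw [integral_finsetSum _ fun i _ => integrable_finsetSum _ fun j _ => (hint i j).const_mul _]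
  simp only [dotProduct, Matrix.mulVec, Finset.mul_sum]
  refine Finset.sum_congr rfl fun i _ => ?_
  rw [integral_finsetSum _ fun j _ => (hint i j).const_mul _]
  refine Finset.sum_congr rfl fun j _ => ?_
  rw [integral_const_mul, momentMatrix, Matrix.of_apply]
  ring

lemma isHermitian_momentMatrix (u : ℝ → ℝ) : (momentMatrix μ n u).IsHermitian := by
  ext i j
  simp only [momentMatrix, Matrix.conjTranspose_apply, Matrix.of_apply, star_trivial]
  exact integral_congr_ae (ae_of_all _ fun x => by ring)

lemma posDef_momentMatrix (hs : InfiniteSupport μ) (hm : HasAllMoments μ) :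
    (momentMatrix μ n fun _ => 1).PosDef := by
  refine Matrix.PosDef.of_dotProduct_mulVec_pos (isHermitian_momentMatrix _) fun v hv => ?_
  rw [star_trivial, ← integral_mul_polynomial_mul_polynomial hm measurable_const
    (C := 1) (by simp)]
  simp only [one_mul, ← sq]
  have hint : Integrable (fun x : ℝ => (∑ k, v k * x ^ (k : ℕ)) ^ 2) μ :=
    (memLp_sum_mul (φ := fun (k : Fin n) x => x ^ (k : ℕ))
      (fun k => hm.memLp_pow k) v).integrable_sq
  refine (integral_nonneg fun x => sq_nonneg _).lt_of_ne fun h0 => ?_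
  rw [eq_comm, integral_eq_zero_iff_of_nonneg (fun x => sq_nonneg _) hint] at h0
  set q : Polynomial ℝ := ∑ k : Fin n, Polynomial.monomial (k : ℕ) (v k) with hq
  have hq0 : q ≠ 0 := by
    obtain ⟨k, hk⟩ := Function.ne_iff.mp hv
    refine fun h => hk ?_
    have := congrArg (fun r : Polynomial ℝ => r.coeff k) h
    simpa [hq, Polynomial.coeff_monomial, Fin.val_inj] using this
  refine hs q.roots.toFinset (measure_mono_null (fun x hx => ?_) (ae_iff.mp h0))
  intro hx0
  refine hx ?_
  have : q.eval x = 0 := by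
    simpa [hq, Polynomial.eval_finsetSum] using hx0
  simpa [hq0] using this

lemma exists_orthonormal_polynomials_diagonalizing (hs : InfiniteSupport μ)
    (hm : HasAllMoments μ) {u : ℝ → ℝ} (hu : Measurable u) {C : ℝ} (hC : ∀ x, |u x| ≤ C) :
    ∃ (B : Matrix (Fin n) (Fin n) ℝ) (d : Fin n → ℝ),
      (IsOrthonormalFamily μ fun i x => ∑ k, B i k * x ^ (k : ℕ)) ∧
      ∀ i j, ∫ x, u x * (∑ k, B i k * x ^ (k : ℕ)) * (∑ k, B j k * x ^ (k : ℕ)) ∂μ =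
        if i = j then d i else 0 := by
  obtain ⟨B, d, h1, h2⟩ := (posDef_momentMatrix (n := n) hs hm).exists_simultaneous_diagonalization
    (isHermitian_momentMatrix u)
  have key : ∀ (M : Matrix (Fin n) (Fin n) ℝ) (i j : Fin n),
      (B * M * Bᵀ) i j = B i ⬝ᵥ (M *ᵥ B j) := by
    intro M i j
    rw [Matrix.mul_assoc, Matrix.mul_apply]
    rfl
  refine ⟨B, d, ⟨fun i => memLp_sum_mul (fun k => hm.memLp_pow k) _, fun i j => ?_⟩,
    fun i j => ?_⟩
  · have := integral_mul_polynomial_mul_polynomial hm (measurable_const (a := (1 : ℝ)))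
      (C := 1) (by simp) (B i) (B j)
    simp only [one_mul] at this
    rw [this, ← key, h1, Matrix.one_apply]
  · rw [integral_mul_polynomial_mul_polynomial hm hu hC, ← key, h2, Matrix.diagonal_apply]

end Moments

section VarianceComparison

variable {n : ℕ} {μ : Measure ℝ} {f : ℝ → ℝ}

lemma measurable_linStat (hf : Measurable f) : Measurable (linStat f : (Fin n → ℝ) → ℝ) := by
  unfold linStat
  fun_prop

lemma abs_linStat_le {M : ℝ} (hM : ∀ x, |f x| ≤ M) (l : Fin n → ℝ) : |linStat f l| ≤ n * M := by
  refine (Finset.abs_sum_le_sum_abs _ _).trans ((Finset.sum_le_sum fun i _ => hM (l i)).trans ?_)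
  simp

lemma integrableExpSet_linStat (hf : Measurable f) {M : ℝ} (hM : ∀ x, |f x| ≤ M)
    (P : Measure (Fin n → ℝ)) [IsFiniteMeasure P] :
    integrableExpSet (linStat f) P = Set.univ :=
  Set.eq_univ_of_forall fun _ =>
    integrable_exp_mul_of_mem_Icc (measurable_linStat hf).aemeasurable
      (ae_of_all _ fun l => abs_le.mp (abs_linStat_le hM l))

/-- Compression of multiplication by `f` to the span of `φ`. -/
def compression (μ : Measure ℝ) (φ : Fin n → ℝ → ℝ) (f : ℝ → ℝ) : Matrix (Fin n) (Fin n) ℝ :=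
  Matrix.of fun i k => ∫ x, f x * φ i x * φ k x ∂μ

variable [SigmaFinite μ] {B : Matrix (Fin n) (Fin n) ℝ}

lemma integral_linStat_sub_mul_slater_sq (hf : Measurable f) {M : ℝ} (hM : ∀ x, |f x| ≤ M)
    {φ : Fin n → ℝ → ℝ} (hφ : IsOrthonormalFamily μ φ) :
    ∫ l, (linStat f l - (compression μ φ f).trace) * slater φ l ^ 2
      ∂(Measure.pi fun _ : Fin n => μ) = 0 :=
  integral_linStat_sub_trace_mul_slater_sq hφ
    (fun i => memLp_orthoResidual hφ.memLp ((hφ.memLp i).bdd_measurable_mul hf hM))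
    (fun i => integral_orthoResidual_mul hφ ((hφ.memLp i).bdd_measurable_mul hf hM))
    fun _ _ => rfl

lemma integral_linStat_sub_sq_mul_slater_sq (hf : Measurable f) {M : ℝ} (hM : ∀ x, |f x| ≤ M)
    {φ : Fin n → ℝ → ℝ} (hφ : IsOrthonormalFamily μ φ) :
    ∫ l, (linStat f l - (compression μ φ f).trace) ^ 2 * slater φ l ^ 2
      ∂(Measure.pi fun _ : Fin n => μ) =
      n.factorial * ∑ i, ∫ x, orthoResidual μ φ (fun y => f y * φ i y) x ^ 2 ∂μ :=
  integral_linStat_sub_trace_sq_mul_slater_sq hφ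
    (fun i => memLp_orthoResidual hφ.memLp ((hφ.memLp i).bdd_measurable_mul hf hM))
    (fun i => integral_orthoResidual_mul hφ ((hφ.memLp i).bdd_measurable_mul hf hM))
    fun _ _ => rfl

lemma variance_linStat_OPE (hf : Measurable f) {M : ℝ} (hM : ∀ x, |f x| ≤ M)
    (hB : IsOrthonormalFamily μ fun i x => ∑ k, B i k * x ^ (k : ℕ)) :
    variance (linStat f) (OPE μ n) = ∑ i, ∫ x, orthoResidual μ
      (fun i x => ∑ k, B i k * x ^ (k : ℕ)) (fun y => f y * ∑ k, B i k * y ^ (k : ℕ)) x ^ 2 ∂μ := by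
  have := isProbabilityMeasure_OPE hB
  have hn : (n.factorial : ℝ) ≠ 0 := by exact_mod_cast n.factorial_ne_zero
  have hmean := integral_OPE hB fun l => linStat f l -
    (compression μ (fun i x => ∑ k, B i k * x ^ (k : ℕ)) f).trace
  have hX : Integrable (linStat f) (OPE μ n) :=
    Integrable.of_bound (measurable_linStat hf).aestronglyMeasurable _
      (ae_of_all _ fun l => abs_linStat_le hM l)
  rw [integral_linStat_sub_mul_slater_sq hf hM hB, mul_zero,
    integral_sub hX (integrable_const _), integral_const, probReal_univ, one_smul,
    sub_eq_zero] at hmean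
  rw [variance_eq_integral (measurable_linStat hf).aemeasurable, hmean, integral_OPE hB,
    integral_linStat_sub_sq_mul_slater_sq hf hM hB, inv_mul_cancel_left₀ hn]

/-- Exponential tilting of the ensemble replaces the orthonormal family by that of the tilted
measure. -/
lemma variance_tilted_linStat_OPE_le (hf : Measurable f) {M : ℝ} (hM : ∀ x, |f x| ≤ M) (s : ℝ)
    (hB : IsOrthonormalFamily μ fun i x => ∑ k, B i k * x ^ (k : ℕ)) {d : Fin n → ℝ}
    (hd : ∀ i, 0 < d i) {ψ : Fin n → ℝ → ℝ}
    (hψ : ∀ i x, ψ i x = (√(d i))⁻¹ * (Real.exp (s * f x / 2) * ∑ k, B i k * x ^ (k : ℕ)))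
    (hψo : IsOrthonormalFamily μ ψ) :
    variance (linStat f) ((OPE μ n).tilted fun l => s * linStat f l) ≤
      ∑ i, ∫ x, orthoResidual μ ψ (fun y => f y * ψ i y) x ^ 2 ∂μ := by
  have := isProbabilityMeasure_OPE hB
  have hn : (n.factorial : ℝ) ≠ 0 := by exact_mod_cast n.factorial_ne_zero
  have hexp : Integrable (fun l => Real.exp (s * linStat f l)) (OPE μ n) := by
    have : s ∈ integrableExpSet (linStat f) (OPE μ n) := by
      simp [integrableExpSet_linStat hf hM]
    exact this
  have := isProbabilityMeasure_tilted hexp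
  have hψ' : (fun i x => (√(d i))⁻¹ * (Real.exp (s * f x / 2) * ∑ k, B i k * x ^ (k : ℕ))) = ψ :=
    funext fun i => funext fun x => (hψ i x).symm
  have hrep : ∀ F : (Fin n → ℝ) → ℝ, ∫ l, Real.exp (s * linStat f l) * F l ∂(OPE μ n) =
      (n.factorial : ℝ)⁻¹ * ((∏ i, d i) *
        ∫ l, F l * slater ψ l ^ 2 ∂(Measure.pi fun _ : Fin n => μ)) := by
    intro F
    rw [integral_OPE hB, ← integral_const_mul (∏ i, d i)]
    congr 2
    ext l
    rw [mul_right_comm, linStat_mul_exp_slater_sq f s hd, hψ']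
    ring
  have hD : (∏ i, d i) ≠ 0 := (Finset.prod_pos fun i _ => hd i).ne'
  have hmgf : ∫ l, Real.exp (s * linStat f l) ∂(OPE μ n) = ∏ i, d i := by
    have := hrep fun _ => 1
    simp only [mul_one, one_mul] at this
    rw [this, integral_slater_sq hψo]
    field_simp
  rw [← variance_sub_const (measurable_linStat hf).aestronglyMeasurable
    (compression μ ψ f).trace]
  refine (variance_le_expectation_sq
    ((measurable_linStat hf).sub_const _).aestronglyMeasurable).trans_eq ?_
  rw [integral_tilted, hmgf]
  simp only [smul_eq_mul, Pi.pow_apply, div_mul_eq_mul_div]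
  rw [integral_div, hrep, integral_linStat_sub_sq_mul_slater_sq hf hM hψo]
  field_simp

end VarianceComparison

section Main

variable {n : ℕ} {μ : Measure ℝ} {f : ℝ → ℝ}

lemma weighted_sub_sum {φ ψ : Fin n → ℝ → ℝ} {w : ℝ → ℝ} {d : Fin n → ℝ} (hd : ∀ i, 0 < d i)
    (hψ : ∀ i x, ψ i x = (√(d i))⁻¹ * (w x * φ i x)) (N : Fin n → ℝ) (i : Fin n) (x : ℝ) :
    f x * ψ i x - ∑ k, N k * (√(d k) * (√(d i))⁻¹) * ψ k x =
      (√(d i))⁻¹ * w x * (f x * φ i x - ∑ k, N k * φ k x) := by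
  rw [mul_sub, Finset.mul_sum]
  congr 1
  · rw [hψ]; ring
  · refine Finset.sum_congr rfl fun k _ => ?_
    have := (Real.sqrt_pos.mpr (hd k)).ne'
    rw [hψ]
    field_simp

/-- If `|s f| ≤ 1/3`, then tilting the ensemble by `exp (s X_f)` increases the variance of `X_f`
by at most a factor `exp (2/3)`. -/
lemma variance_tilted_linStat_OPE_le_mul [SigmaFinite μ] (hs : InfiniteSupport μ)
    (hm : HasAllMoments μ) (hf : Measurable f) {M : ℝ} (hM : ∀ x, |f x| ≤ M) {s : ℝ}
    (hsf : ∀ x, |s * f x| ≤ 1 / 3) :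
    variance (linStat f) ((OPE μ n).tilted fun l => s * linStat f l) ≤
      Real.exp (2 / 3) * variance (linStat f) (OPE μ n) := by
  have hum : Measurable fun x => Real.exp (s * f x) := by fun_prop
  have hwm : Measurable fun x => Real.exp (s * f x / 2) := by fun_prop
  have huC : ∀ x, |Real.exp (s * f x)| ≤ Real.exp (1 / 3) := fun x => by
    rw [Real.abs_exp]
    exact Real.exp_le_exp.mpr ((le_abs_self _).trans (hsf x))
  have hwC : ∀ x, |Real.exp (s * f x / 2)| ≤ Real.exp (1 / 3) := fun x => by
    rw [Real.abs_exp]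
    have := (abs_le.mp (hsf x)).2
    exact Real.exp_le_exp.mpr (by linarith)
  have hww : ∀ x, Real.exp (s * f x / 2) * Real.exp (s * f x / 2) = Real.exp (s * f x) :=
    fun x => by rw [← Real.exp_add, add_halves]
  obtain ⟨B, d, hB, hBd⟩ := exists_orthonormal_polynomials_diagonalizing (n := n) hs hm hum huC
  set p : Fin n → ℝ → ℝ := fun i x => ∑ k, B i k * x ^ (k : ℕ) with hp
  have hdle : ∀ i, Real.exp (-(1 / 3)) ≤ d i := by
    intro i
    have h1 := hB.integral_mul i i
    have h2 := hBd i i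
    simp only [if_true] at h1 h2
    suffices h : Real.exp (-(1 / 3)) * ∫ x, p i x * p i x ∂μ ≤ d i by rwa [h1, mul_one] at h
    rw [← h2, ← integral_const_mul]
    refine integral_mono (((hB.memLp i).integrable_mul (hB.memLp i)).const_mul _)
      (((hB.memLp i).bdd_measurable_mul hum huC).integrable_mul (hB.memLp i)) fun x => ?_
    change _ ≤ Real.exp (s * f x) * p i x * p i x
    rw [mul_assoc]
    exact mul_le_mul_of_nonneg_right
      (Real.exp_le_exp.mpr (abs_le.mp (hsf x)).1) (mul_self_nonneg _)
  have hd : ∀ i, 0 < d i := fun i => (Real.exp_pos _).trans_le (hdle i)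
  have hsd : ∀ i, √(d i) ≠ 0 := fun i => (Real.sqrt_pos.mpr (hd i)).ne'
  set ψ : Fin n → ℝ → ℝ := fun i x => (√(d i))⁻¹ * (Real.exp (s * f x / 2) * p i x) with hψ
  have hψo : IsOrthonormalFamily μ ψ := by
    refine ⟨fun i => ((hB.memLp i).bdd_measurable_mul hwm hwC).const_mul _, fun i j => ?_⟩
    have hrw : ∀ x, ψ i x * ψ j x =
        (√(d i))⁻¹ * (√(d j))⁻¹ * (Real.exp (s * f x) * p i x * p j x) := fun x => by
      rw [← hww x]
      ring
    simp only [hrw]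
    rw [integral_const_mul, hBd]
    split_ifs with hij
    · subst hij
      rw [← mul_inv, Real.mul_self_sqrt (hd i).le, inv_mul_cancel₀ (hd i).ne']
    · rw [mul_zero]
  refine (variance_tilted_linStat_OPE_le hf hM s hB hd (fun _ _ => rfl) hψo).trans ?_
  rw [variance_linStat_OPE hf hM hB, Finset.mul_sum]
  refine Finset.sum_le_sum fun i _ => ?_
  have hgm : MemLp (orthoResidual μ p fun y => f y * p i y) 2 μ :=
    memLp_orthoResidual hB.memLp ((hB.memLp i).bdd_measurable_mul hf hM)
  refine (integral_orthoResidual_sq_le hψo ((hψo.memLp i).bdd_measurable_mul hf hM)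
    fun k => (∫ y, f y * p i y * p k y ∂μ) * (√(d k) * (√(d i))⁻¹)).trans ?_
  rw [← integral_const_mul]
  refine integral_mono_of_nonneg (ae_of_all _ fun x => sq_nonneg _)
    (hgm.integrable_sq.const_mul _) (ae_of_all _ fun x => ?_)
  have hfactor : f x * ψ i x -
      ∑ k, (∫ y, f y * p i y * p k y ∂μ) * (√(d k) * (√(d i))⁻¹) * ψ k x =
      (√(d i))⁻¹ * Real.exp (s * f x / 2) * orthoResidual μ p (fun y => f y * p i y) x :=
    weighted_sub_sum (φ := p) (ψ := ψ) (w := fun x => Real.exp (s * f x / 2)) hd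
      (fun _ _ => rfl) (fun k => ∫ y, f y * p i y * p k y ∂μ) i x
  have hdinv : (d i)⁻¹ ≤ Real.exp (1 / 3) := by
    have := inv_anti₀ (Real.exp_pos _) (hdle i)
    rwa [← Real.exp_neg, neg_neg] at this
  change (f x * ψ i x -
    ∑ k, (∫ y, f y * p i y * p k y ∂μ) * (√(d k) * (√(d i))⁻¹) * ψ k x) ^ 2 ≤ _
  rw [hfactor, mul_pow, mul_pow, inv_pow, Real.sq_sqrt (hd i).le, sq (Real.exp _), hww]
  refine mul_le_mul_of_nonneg_right ?_ (sq_nonneg _)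
  calc (d i)⁻¹ * Real.exp (s * f x) ≤ Real.exp (1 / 3) * Real.exp (1 / 3) :=
        mul_le_mul hdinv ((le_abs_self _).trans (huC x)) (Real.exp_pos _).le (Real.exp_pos _).le
    _ = Real.exp (2 / 3) := by rw [← Real.exp_add]; norm_num

/-- Second-order Taylor bound for the cumulant generating function of a random variable with
everywhere finite moment generating function. -/
lemma abs_cgf_sub_le {Ω : Type*} [MeasurableSpace Ω] {P : Measure Ω} [IsProbabilityMeasure P]
    {X : Ω → ℝ} (hX : integrableExpSet X P = Set.univ) {t K : ℝ}
    (hK : ∀ s, |s| ≤ |t| → variance X (P.tilted fun ω => s * X ω) ≤ K) :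
    |cgf X P t - t * ∫ ω, X ω ∂P| ≤ K / 2 * t ^ 2 := by
  have hint : ∀ s, s ∈ interior (integrableExpSet X P) := by simp [hX]
  rcases eq_or_ne t 0 with rfl | ht
  · simp
  have hcd : ContDiffOn ℝ ((1 : ℕ) + 1) (cgf X P) (Set.uIcc 0 t) :=
    (analyticOn_cgf.mono fun s _ => hint s).contDiffOn (uniqueDiffOn_uIcc ht.symm)
  obtain ⟨s, hst, h⟩ := taylor_mean_remainder_lagrange_iteratedDeriv ht.symm hcd
  have hd : derivWithin (cgf X P) (Set.uIcc 0 t) 0 = ∫ ω, X ω ∂P := by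
    rw [(analyticAt_cgf (hint 0)).differentiableAt.derivWithin
      (uniqueDiffOn_uIcc ht.symm 0 Set.left_mem_uIcc), deriv_cgf_zero (hint 0)]
    simp
  have hTaylor : taylorWithinEval (cgf X P) 1 (Set.uIcc 0 t) 0 t = t * ∫ ω, X ω ∂P := by
    rw [taylorWithinEval_succ, taylor_within_zero_eval, iteratedDerivWithin_one, hd, cgf_zero]
    simp
  have hvar : iteratedDeriv 2 (cgf X P) s ≤ K := by
    rw [← variance_tilted_mul (hint s)]
    refine hK s ?_
    have := Set.abs_sub_left_of_mem_uIcc (Set.uIoo_subset_uIcc_self hst)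
    simpa using this
  have hvar0 : 0 ≤ iteratedDeriv 2 (cgf X P) s := by
    rw [← variance_tilted_mul (hint s)]
    exact variance_nonneg _ _
  rw [hTaylor] at h
  simp only [Nat.reduceAdd, sub_zero, Nat.factorial_two, Nat.cast_ofNat] at h
  rw [h, abs_of_nonneg (by positivity)]
  nlinarith [sq_nonneg t]

end Main

/-- **Bound on the moment generating function** (Lemma 3.2 applied to OPEs): there is a
universal constant `A > 0` (one may take `A = 2e² Σ_{m≥0} (e/3)^m (m+2)^{3/2}`) such that
for every probability measure `μ` on `ℝ` with infinite support and all moments finite,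
every bounded measurable `f`, every `n` and every `t` with `|t| ≤ 1/(3‖f‖_∞)`,
`|log E[exp(t X_f)] - t E[X_f]| ≤ A t² Var X_f`. -/
theorem mgf_bound :
    ∃ A : ℝ, 0 < A ∧
      ∀ (μ : Measure ℝ), IsProbabilityMeasure μ → InfiniteSupport μ → HasAllMoments μ →
        ∀ f : ℝ → ℝ, Measurable f → (∃ C : ℝ, ∀ x, |f x| ≤ C) →
          ∀ n : ℕ, ∀ t : ℝ, |t| ≤ 1 / (3 * supNorm f) →
            |Real.log (∫ l, Real.exp (t * linStat f l) ∂(OPE μ n)) -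
                t * ∫ l, linStat f l ∂(OPE μ n)| ≤
              A * t ^ 2 * variance (fun l : Fin n → ℝ => linStat f l) (OPE μ n) := by
  refine ⟨Real.exp (2 / 3) / 2, by positivity, fun μ hμ hs hm f hf hb n t ht => ?_⟩
  have hM : ∀ x, |f x| ≤ supNorm f := fun x =>
    le_ciSup (f := fun x => |f x|) (hb.imp fun C hC => by rintro _ ⟨y, rfl⟩; exact hC y) x
  have hM0 : 0 ≤ supNorm f := (abs_nonneg _).trans (hM 0)
  have htM : |t| * supNorm f ≤ 1 / 3 := by
    rcases hM0.eq_or_lt with h0 | h0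
    · rw [← h0]; norm_num
    · rw [le_div_iff₀ (by positivity)] at ht
      linarith
  obtain ⟨B, -, hB, -⟩ := exists_orthonormal_polynomials_diagonalizing (n := n) hs hm
    (measurable_const (a := (1 : ℝ))) (C := 1) (by simp)
  have := isProbabilityMeasure_OPE hB
  refine (abs_cgf_sub_le (integrableExpSet_linStat hf hM (OPE μ n)) fun s hst =>
    variance_tilted_linStat_OPE_le_mul hs hm hf hM fun x => ?_).trans_eq
      (by ring_nf)
  rw [abs_mul]
  exact (mul_le_mul hst (hM x) (abs_nonneg _) (abs_nonneg _)).trans htM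

end
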